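/- (Soundness) For any set of axioms Ax ⊆ L⇛ and any Γ ∪ {φ} ⊆ L⇛: if Γ ⊢_Ax φ then Γ ⊨_Ax φ, i.e. every flat frame that validates every formula of Ax validates the consecution Γ ⇒ φ. -/

import Mathlib

/-- Formulas of the language `L⇛`. -/
inductive Fml : Type where
  | var : Nat → Fml
  | top : Fml
  | bot : Fml
  | and : Fml → Fml → Fml
  | or  : Fml → Fml → Fml
  | imp : Fml → Fml → Fml
  | sto : Fml → Fml → Fml
deriving DecidableEq

/-- Uniform substitution. -/
def Fml.subst (σ : Nat → Fml) : Fml → Fml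
  | .var p => σ p
  | .top => .top
  | .bot => .bot
  | .and φ ψ => .and (φ.subst σ) (ψ.subst σ)
  | .or φ ψ => .or (φ.subst σ) (ψ.subst σ)
  | .imp φ ψ => .imp (φ.subst σ) (ψ.subst σ)
  | .sto φ ψ => .sto (φ.subst σ) (ψ.subst σ)

/-- Conjunction `φ₁ ∧ ⋯ ∧ φₙ` of a list of formulas (`⊤` for the empty list). -/
def Fml.conj : List Fml → Fml
  | [] => .top
  | [φ] => φ
  | φ :: ψ :: rest => .and φ (Fml.conj (ψ :: rest))

/-- Disjunction `φ₁ ∨ ⋯ ∨ φₙ` of a list of formulas (`⊥` for the empty list). -/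
def Fml.disj : List Fml → Fml
  | [] => .bot
  | [φ] => φ
  | φ :: ψ :: rest => .or φ (Fml.disj (ψ :: rest))

/-- Axiom schemes of intuitionistic propositional logic (a standard Hilbert-style
axiomatisation); as schemes, they comprise all substitution instances. -/
inductive IpcAx : Fml → Prop where
  | k (φ ψ : Fml) : IpcAx (.imp φ (.imp ψ φ))
  | s (φ ψ χ : Fml) : IpcAx (.imp (.imp φ (.imp ψ χ)) (.imp (.imp φ ψ) (.imp φ χ)))
  | andE1 (φ ψ : Fml) : IpcAx (.imp (.and φ ψ) φ)
  | andE2 (φ ψ : Fml) : IpcAx (.imp (.and φ ψ) ψ)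
  | andI (φ ψ : Fml) : IpcAx (.imp φ (.imp ψ (.and φ ψ)))
  | orI1 (φ ψ : Fml) : IpcAx (.imp φ (.or φ ψ))
  | orI2 (φ ψ : Fml) : IpcAx (.imp ψ (.or φ ψ))
  | orE (φ ψ χ : Fml) : IpcAx (.imp (.imp φ χ) (.imp (.imp ψ χ) (.imp (.or φ ψ) χ)))
  | botE (φ : Fml) : IpcAx (.imp .bot φ)
  | top : IpcAx .top

/-- Substitution instances of the axioms of intuitionistic logic together with
`k_a : ((p⇛q)∧(p⇛r))→(p⇛(q∧r))` and `tr : ((p⇛q)∧(q⇛r))→(p⇛r)`. -/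
inductive BaseAx : Fml → Prop where
  | ipc {φ : Fml} : IpcAx φ → BaseAx φ
  | ka (φ ψ χ : Fml) : BaseAx (.imp (.and (.sto φ ψ) (.sto φ χ)) (.sto φ (.and ψ χ)))
  | tr (φ ψ χ : Fml) : BaseAx (.imp (.and (.sto φ ψ) (.sto ψ χ)) (.sto φ χ))

/-- Derivability of the consecution `Γ ⇒ φ` in `HLC♭ ⊕ Ax`, i.e. `Γ ⊢_Ax φ`. -/
inductive Deriv (Ax : Set Fml) : Set Fml → Fml → Prop where
  | base {Γ : Set Fml} {φ : Fml} : BaseAx φ → Deriv Ax Γ φ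
  | axm {Γ : Set Fml} {ψ : Fml} (σ : Nat → Fml) : ψ ∈ Ax → Deriv Ax Γ (ψ.subst σ)
  | el {Γ : Set Fml} {φ : Fml} : φ ∈ Γ → Deriv Ax Γ φ
  | mp {Γ : Set Fml} {φ ψ : Fml} : Deriv Ax Γ φ → Deriv Ax Γ (.imp φ ψ) → Deriv Ax Γ ψ
  | na {Γ : Set Fml} {φ ψ : Fml} : Deriv Ax (∅ : Set Fml) (.imp φ ψ) → Deriv Ax Γ (.sto φ ψ)

/-- A flat frame: a nonempty set of worlds with a preorder `≼` and a relation `R`. -/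
structure FlatFrame : Type 1 where
  W : Type
  ne : Nonempty W
  le : W → W → Prop
  le_refl : ∀ w, le w w
  le_trans : ∀ ⦃w v u⦄, le w v → le v u → le w u
  R : W → W → Prop

/-- A valuation is admissible if every proposition letter denotes an upset. -/
def FlatFrame.IsUpset (F : FlatFrame) (V : Nat → F.W → Prop) : Prop :=
  ∀ p ⦃w v⦄, F.le w v → V p w → V p v

/-- Truth of a formula at a world of a flat model: the usual intuitionistic Kripke
clauses over `≼`, and `w ⊨ φ⇛ψ` iff for every `w' ≽ w`, `R[w'] ⊆ ⟦φ⟧` implies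
`R[w'] ⊆ ⟦ψ⟧`. -/
def FlatFrame.sat (F : FlatFrame) (V : Nat → F.W → Prop) : Fml → F.W → Prop
  | .var p, w => V p w
  | .top, _ => True
  | .bot, _ => False
  | .and φ ψ, w => F.sat V φ w ∧ F.sat V ψ w
  | .or φ ψ, w => F.sat V φ w ∨ F.sat V ψ w
  | .imp φ ψ, w => ∀ v, F.le w v → F.sat V φ v → F.sat V ψ v
  | .sto φ ψ, w => ∀ w', F.le w w' →
      (∀ v, F.R w' v → F.sat V φ v) → ∀ v, F.R w' v → F.sat V ψ v

/-- A flat frame validates the consecution `Γ ⇒ φ` if in every model on it, every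
world satisfying all formulas of `Γ` satisfies `φ`. -/
def FlatFrame.ValidCons (F : FlatFrame) (Γ : Set Fml) (φ : Fml) : Prop :=
  ∀ V, F.IsUpset V → ∀ w, (∀ ψ ∈ Γ, F.sat V ψ w) → F.sat V φ w

/-- A flat frame validates a formula if it is true at every world in every model on it. -/
def FlatFrame.ValidFml (F : FlatFrame) (φ : Fml) : Prop :=
  ∀ V, F.IsUpset V → ∀ w, F.sat V φ w

/-- Persistence: in a flat model, the truth set of every formula is an upset. -/
theorem FlatFrame.sat_mono (F : FlatFrame) {V : Nat → F.W → Prop} (hV : F.IsUpset V) (φ : Fml)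
    {w v : F.W} (hwv : F.le w v) (h : F.sat V φ w) : F.sat V φ v := by
  induction φ with
  | var p => exact hV p hwv h
  | top => trivial
  | bot => exact h
  | and φ ψ ihφ ihψ => exact ⟨ihφ h.1, ihψ h.2⟩
  | or φ ψ ihφ ihψ => exact h.imp ihφ ihψ
  | imp φ ψ _ _ => exact fun u hu => h u (F.le_trans hwv hu)
  | sto φ ψ _ _ => exact fun u hu => h u (F.le_trans hwv hu)

/-- Substituting into a formula amounts to changing the valuation. -/
theorem FlatFrame.sat_subst (F : FlatFrame) (V : Nat → F.W → Prop) (σ : Nat → Fml) (φ : Fml)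
    (w : F.W) : F.sat V (φ.subst σ) w ↔ F.sat (fun p => F.sat V (σ p)) φ w := by
  induction φ generalizing w with
  | var p => rfl
  | top => rfl
  | bot => rfl
  | _ φ ψ ihφ ihψ => simp only [Fml.subst, FlatFrame.sat, ihφ, ihψ]

/-- Formulas valid on a flat frame are closed under substitution. -/
theorem FlatFrame.ValidFml.subst {F : FlatFrame} {φ : Fml} (h : F.ValidFml φ) (σ : Nat → Fml) :
    F.ValidFml (φ.subst σ) := fun V hV w =>
  (F.sat_subst V σ φ w).2 (h _ (fun p _ _ hwv => F.sat_mono hV (σ p) hwv) w)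

/-- The intuitionistic axioms are valid on every flat frame. -/
theorem IpcAx.validFml {φ : Fml} (h : IpcAx φ) (F : FlatFrame) : F.ValidFml φ := by
  intro V hV w
  cases h with
  | k φ ψ => exact fun _ _ hφ _ hu _ => F.sat_mono hV φ hu hφ
  | s φ ψ χ =>
    exact fun _ _ h₁ _ hu h₂ x hx hφ => h₁ x (F.le_trans hu hx) hφ x (F.le_refl x) (h₂ x hx hφ)
  | andE1 => exact fun _ _ h => h.1
  | andE2 => exact fun _ _ h => h.2
  | andI φ ψ => exact fun _ _ hφ _ hu hψ => ⟨F.sat_mono hV φ hu hφ, hψ⟩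
  | orI1 => exact fun _ _ h => Or.inl h
  | orI2 => exact fun _ _ h => Or.inr h
  | orE φ ψ χ =>
    exact fun _ _ h₁ _ hu h₂ x hx h => h.elim (h₁ x (F.le_trans hu hx)) (h₂ x hx)
  | botE => exact fun _ _ h => h.elim
  | top => trivial

/-- The base axioms are valid on every flat frame. -/
theorem BaseAx.validFml {φ : Fml} (h : BaseAx φ) (F : FlatFrame) : F.ValidFml φ := by
  cases h with
  | ipc h => exact h.validFml F
  | ka => exact fun _ _ _ _ _ h u hu hφ x hx => ⟨h.1 u hu hφ x hx, h.2 u hu hφ x hx⟩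
  | tr => exact fun _ _ _ _ _ h u hu hφ => h.2 u hu (h.1 u hu hφ)

/-- soundness: if `Γ ⊢_Ax φ` then every flat frame validating every
formula of `Ax` validates the consecution `Γ ⇒ φ`. -/
theorem soundness (Ax Γ : Set Fml) (φ : Fml) (h : Deriv Ax Γ φ) :
    ∀ F : FlatFrame, (∀ ψ ∈ Ax, F.ValidFml ψ) → F.ValidCons Γ φ := by
  intro F hF
  induction h with
  | base h => exact fun V hV w _ => h.validFml F V hV w
  | axm σ h => exact fun V hV w _ => (hF _ h).subst σ V hV w
  | el h => exact fun _ _ _ hΓ => hΓ _ h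
  | mp _ _ ih₁ ih₂ => exact fun V hV w hΓ => ih₂ V hV w hΓ w (F.le_refl w) (ih₁ V hV w hΓ)
  | na _ ih =>
    exact fun V hV _ _ _ _ hφ v hv =>
      ih V hV v (fun _ hψ => hψ.elim) v (F.le_refl v) (hφ v hv)
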